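/- arXiv:1807.07569 — 6 statements merged into one kernel-verified Lean document; each statement's English description precedes it below -/
import Mathlib

section
/- Let n ≥ 1, let x ∈ ℝⁿ be a fixed (deterministic) clean image, and let N = (N₁,…,Nₙ) be a random vector with independent coordinates satisfying E[Nᵢ] = 0 and E[Nᵢ²] = σ² for every i, where σ > 0. Set Z = x + N. For each pixel i let the denoiser be the first-order polynomial pixelwise mapping X̂ᵢ(Z) = a₁(Z^{-i})·Zᵢ + a₀(Z^{-i}), where a₀, a₁ are bounded measurable functions of the coordinates of Z other than i. Then the estimated loss is an unbiased estimator of the MSE: E[ (1/n)‖Z − X̂(Z)‖² + (σ²/n)·Σᵢ (2·a₁(Z^{-i}) − 1) ] = E[ (1/n)‖x − X̂(Z)‖² ]. -/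
open MeasureTheory ProbabilityTheory

lemma aux_indep_zero {Ω : Type*} [MeasurableSpace Ω] (μ : Measure Ω) [IsProbabilityMeasure μ]
    (n : ℕ) (x : Fin n → ℝ) (N : Fin n → Ω → ℝ)
    (hNmeas : ∀ i, Measurable (N i)) (hindep : iIndepFun N μ) (i : Fin n)
    (f : ℝ → ℝ) (hf : Measurable f) (hfi : Integrable (fun ω => f (N i ω)) μ)
    (hf0 : ∫ ω, f (N i ω) ∂μ = 0)
    (c : ({j : Fin n // j ≠ i} → ℝ) → ℝ) (hc : Measurable c) (hb : ∃ C, ∀ v, |c v| ≤ C) :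
    Integrable (fun ω => f (N i ω) * c (fun j => x j.1 + N j.1 ω)) μ ∧
      ∫ ω, f (N i ω) * c (fun j => x j.1 + N j.1 ω) ∂μ = 0 := by
  obtain ⟨C, hC⟩ := hb
  have hcm : Measurable (fun ω => c (fun j => x j.1 + N j.1 ω)) :=
    hc.comp (measurable_pi_lambda _ fun j => (hNmeas j.1).const_add _)
  refine ⟨hfi.mul_bdd (c := C) hcm.aestronglyMeasurable (ae_of_all _ fun ω => hC _), ?_⟩
  have hI := hindep.indepFun_finset {i} (Finset.univ.erase i) (by simp) hNmeas
  have hT : Measurable (fun v : ↥(Finset.univ.erase i : Finset (Fin n)) → ℝ =>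
      c (fun j => x j.1 + v ⟨j.1, by simp [j.2]⟩)) :=
    hc.comp (measurable_pi_lambda _ fun j => (measurable_pi_apply _).const_add _)
  have hS : Measurable (fun v : ({i} : Finset (Fin n)) → ℝ => f (v ⟨i, by simp⟩)) :=
    hf.comp (measurable_pi_apply _)
  have hJ : IndepFun (fun ω => f (N i ω)) (fun ω => c (fun j => x j.1 + N j.1 ω)) μ :=
    hI.comp hS hT
  rw [hJ.integral_fun_mul_eq_mul_integral hfi.aestronglyMeasurable hcm.aestronglyMeasurable,
    hf0, zero_mul]

/-- unbiasedness of the estimated loss for first-order (`d = 1`)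
polynomial pixelwise denoisers. For a deterministic clean image `x ∈ ℝⁿ`, noise `N`
with independent, zero-mean, variance-`σ²` coordinates, `Z = x + N`, and the denoiser
`X̂ᵢ(Z) = a₁(Z^{-i})·Zᵢ + a₀(Z^{-i})` with bounded measurable coefficient functions,
`E[(1/n)‖Z − X̂(Z)‖² + (σ²/n)·Σᵢ (2a₁(Z^{-i}) − 1)] = E[(1/n)‖x − X̂(Z)‖²]`. -/
theorem affine_estimated_loss_unbiased
    {Ω : Type*} [MeasurableSpace Ω] (μ : Measure Ω) [IsProbabilityMeasure μ]
    (n : ℕ) (hn : 1 ≤ n) (x : Fin n → ℝ) (σ : ℝ) (hσ : 0 < σ)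
    (N : Fin n → Ω → ℝ)
    (hNmeas : ∀ i, Measurable (N i))
    (hindep : iIndepFun N μ)
    (hmean : ∀ i, ∫ ω, N i ω ∂μ = 0)
    (hvar : ∀ i, ∫ ω, (N i ω) ^ 2 ∂μ = σ ^ 2)
    (hN2int : ∀ i, Integrable (fun ω => (N i ω) ^ 2) μ)
    (Z : Ω → Fin n → ℝ) (hZ : ∀ ω i, Z ω i = x i + N i ω)
    (a₀ a₁ : (i : Fin n) → ({j : Fin n // j ≠ i} → ℝ) → ℝ)
    (hmeas₀ : ∀ i, Measurable (a₀ i)) (hmeas₁ : ∀ i, Measurable (a₁ i))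
    (hbdd₀ : ∀ i, ∃ C, ∀ v, |a₀ i v| ≤ C)
    (hbdd₁ : ∀ i, ∃ C, ∀ v, |a₁ i v| ≤ C)
    (Xhat : Ω → Fin n → ℝ)
    (hXhat : ∀ ω i, Xhat ω i
      = a₁ i (fun j => Z ω j.1) * Z ω i + a₀ i (fun j => Z ω j.1)) :
    ∫ ω, ((1 / (n : ℝ)) * ∑ i, (Z ω i - Xhat ω i) ^ 2
        + σ ^ 2 / (n : ℝ) * ∑ i, (2 * a₁ i (fun j => Z ω j.1) - 1)) ∂μ
      = ∫ ω, (1 / (n : ℝ)) * ∑ i, (x i - Xhat ω i) ^ 2 ∂μ := by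
  have key : ∀ i, Integrable (fun ω => (N i ω ^ 2 - σ ^ 2) * (1 - 2 * a₁ i (fun j => Z ω j.1))
        + N i ω * (2 * (x i - a₁ i (fun j => Z ω j.1) * x i - a₀ i (fun j => Z ω j.1)))) μ ∧
      ∫ ω, ((N i ω ^ 2 - σ ^ 2) * (1 - 2 * a₁ i (fun j => Z ω j.1))
        + N i ω * (2 * (x i - a₁ i (fun j => Z ω j.1) * x i - a₀ i (fun j => Z ω j.1)))) ∂μ
        = 0 := by
    intro i
    obtain ⟨C₀, h₀⟩ := hbdd₀ i
    obtain ⟨C₁, h₁⟩ := hbdd₁ i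
    have hNi : Integrable (N i) μ :=
      ((memLp_two_iff_integrable_sq (hNmeas i).aestronglyMeasurable).2 (hN2int i)).integrable
        (by norm_num)
    have m₀ := hmeas₀ i
    have m₁ := hmeas₁ i
    have A := aux_indep_zero μ n x N hNmeas hindep i (fun t => t ^ 2 - σ ^ 2) (by fun_prop)
      ((hN2int i).sub (integrable_const _))
      (by rw [integral_sub (hN2int i) (integrable_const _), hvar i]; simp)
      (fun v => 1 - 2 * a₁ i v) (by fun_prop)
      ⟨1 + 2 * C₁, fun v => by
        have := abs_le.1 (h₁ v)
        exact abs_le.2 ⟨by linarith, by linarith⟩⟩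
    have B := aux_indep_zero μ n x N hNmeas hindep i (fun t => t) (by fun_prop)
      hNi (hmean i)
      (fun v => 2 * (x i - a₁ i v * x i - a₀ i v)) (by fun_prop)
      ⟨2 * (|x i| + C₁ * |x i| + C₀), fun v => by
        rw [abs_mul, abs_two]
        have e1 := abs_sub (x i - a₁ i v * x i) (a₀ i v)
        have e2 := abs_sub (x i) (a₁ i v * x i)
        have e3 : |a₁ i v * x i| ≤ C₁ * |x i| := by
          rw [abs_mul]; exact mul_le_mul_of_nonneg_right (h₁ v) (abs_nonneg _)
        linarith [h₀ v]⟩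
    simp only [hZ]
    exact ⟨A.1.add B.1, by rw [integral_add A.1 B.1, A.2, B.2, add_zero]⟩
  have hint := (integrable_finsetSum Finset.univ fun i _ => (key i).1).const_mul (1 / (n : ℝ))
  have hzero : ∫ ω, (1 / (n : ℝ)) * ∑ i, ((N i ω ^ 2 - σ ^ 2) * (1 - 2 * a₁ i (fun j => Z ω j.1))
        + N i ω * (2 * (x i - a₁ i (fun j => Z ω j.1) * x i - a₀ i (fun j => Z ω j.1)))) ∂μ
        = 0 := by
    rw [integral_const_mul, integral_finsetSum _ fun i _ => (key i).1]
    simp [fun i => (key i).2]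
  have heq : ∀ ω, ((1 / (n : ℝ)) * ∑ i, (Z ω i - Xhat ω i) ^ 2
        + σ ^ 2 / (n : ℝ) * ∑ i, (2 * a₁ i (fun j => Z ω j.1) - 1))
      = (1 / (n : ℝ)) * ∑ i, (x i - Xhat ω i) ^ 2
        + (1 / (n : ℝ)) * ∑ i, ((N i ω ^ 2 - σ ^ 2) * (1 - 2 * a₁ i (fun j => Z ω j.1))
        + N i ω * (2 * (x i - a₁ i (fun j => Z ω j.1) * x i - a₀ i (fun j => Z ω j.1)))) := by
    intro ω
    simp only [Finset.mul_sum, ← Finset.sum_add_distrib]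
    refine Finset.sum_congr rfl fun i _ => ?_
    have hN : N i ω = Z ω i - x i := by rw [hZ]; ring
    rw [hXhat, hN]
    ring
  simp only [heq]
  by_cases hg : Integrable (fun ω => (1 / (n : ℝ)) * ∑ i, (x i - Xhat ω i) ^ 2) μ
  · rw [integral_add hg hint, hzero, add_zero]
  · rw [integral_undef hg, integral_undef]
    intro h
    apply hg
    refine (h.sub hint).congr (ae_of_all _ fun ω => ?_)
    simp
end

section
/- Let n ≥ 1, let x ∈ ℝⁿ be a fixed (deterministic) clean image, and let N = (N₁,…,Nₙ) be a random vector with independent coordinates satisfying E[Nᵢ] = 0, E[Nᵢ²] = σ² (σ > 0), E[|Nᵢ|³] < ∞, and each Nᵢ having a symmetric distribution (Nᵢ and −Nᵢ identically distributed). Set Z = x + N. For each pixel i let the denoiser be the second-order polynomial pixelwise mapping X̂ᵢ(Z) = a₂(Z^{-i})·Zᵢ² + a₁(Z^{-i})·Zᵢ + a₀(Z^{-i}), where a₀, a₁, a₂ are bounded measurable functions of the coordinates of Z other than i. Then E[ (1/n)‖Z − X̂(Z)‖² + (σ²/n)·Σᵢ (2·a₁(Z^{-i}) + 4·a₂(Z^{-i})·Zᵢ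 − 1) ] = E[ (1/n)‖x − X̂(Z)‖² ]. -/
open MeasureTheory ProbabilityTheory

lemma indep_aux {Ω : Type*} [MeasurableSpace Ω] (μ : Measure Ω) [IsProbabilityMeasure μ]
    (n : ℕ) (x : Fin n → ℝ) (N : Fin n → Ω → ℝ) (hNmeas : ∀ i, Measurable (N i))
    (hindep : iIndepFun N μ) (i : Fin n) (a : ({j : Fin n // j ≠ i} → ℝ) → ℝ)
    (ha : Measurable a) (C : ℝ) (hC : ∀ v, |a v| ≤ C)
    (p : ℝ → ℝ) (hp : Measurable p) (hpi : Integrable (fun ω => p (N i ω)) μ)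
    (hp0 : ∫ ω, p (N i ω) ∂μ = 0) :
    Integrable (fun ω => a (fun j => x j.1 + N j.1 ω) * p (N i ω)) μ ∧
    ∫ ω, a (fun j => x j.1 + N j.1 ω) * p (N i ω) ∂μ = 0 := by
  have hm : Measurable (fun ω => a (fun j => x j.1 + N j.1 ω)) := by
    apply ha.comp
    exact measurable_pi_lambda _ (fun j => (hNmeas j.1).const_add _)
  have hI := hindep.indepFun_finset (Finset.univ.erase i) {i} (by simp) hNmeas
  have hI2 : IndepFun (fun ω => a (fun j => x j.1 + N j.1 ω)) (fun ω => p (N i ω)) μ := by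
    have := hI.comp
      (φ := fun v : ({j : Fin n // j ∈ Finset.univ.erase i} → ℝ) =>
        a (fun j => x j.1 + v ⟨j.1, by simp [j.2]⟩))
      (ψ := fun v : ({j : Fin n // j ∈ ({i} : Finset (Fin n))} → ℝ) => p (v ⟨i, by simp⟩))
      (ha.comp (measurable_pi_lambda _ (fun j => (measurable_pi_apply _).const_add _)))
      (hp.comp (measurable_pi_apply _))
    exact this
  refine ⟨hpi.bdd_mul (c := C) hm.aestronglyMeasurable
    (Filter.Eventually.of_forall fun ω => hC _), ?_⟩
  rw [hI2.integral_fun_mul_eq_mul_integral hm.aestronglyMeasurable hpi.aestronglyMeasurable, hp0,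
    mul_zero]

/-- unbiasedness of the estimated loss for second-order (`d = 2`)
polynomial pixelwise denoisers, under independent, zero-mean, variance-`σ²`,
symmetrically distributed noise coordinates with finite third absolute moments.
For `Z = x + N` and `X̂ᵢ(Z) = a₂(Z^{-i})Zᵢ² + a₁(Z^{-i})Zᵢ + a₀(Z^{-i})`,
`E[(1/n)‖Z − X̂(Z)‖² + (σ²/n)Σᵢ(2a₁(Z^{-i}) + 4a₂(Z^{-i})Zᵢ − 1)]
   = E[(1/n)‖x − X̂(Z)‖²]`. -/
theorem quadratic_estimated_loss_unbiased_symmetric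
    {Ω : Type*} [MeasurableSpace Ω] (μ : Measure Ω) [IsProbabilityMeasure μ]
    (n : ℕ) (hn : 1 ≤ n) (x : Fin n → ℝ) (σ : ℝ) (hσ : 0 < σ)
    (N : Fin n → Ω → ℝ)
    (hNmeas : ∀ i, Measurable (N i))
    (hindep : iIndepFun N μ)
    (hmean : ∀ i, ∫ ω, N i ω ∂μ = 0)
    (hvar : ∀ i, ∫ ω, (N i ω) ^ 2 ∂μ = σ ^ 2)
    (hN2int : ∀ i, Integrable (fun ω => (N i ω) ^ 2) μ)
    (hN3int : ∀ i, Integrable (fun ω => |N i ω| ^ 3) μ)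
    (hsymm : ∀ i, Measure.map (N i) μ = Measure.map (fun ω => -N i ω) μ)
    (Z : Ω → Fin n → ℝ) (hZ : ∀ ω i, Z ω i = x i + N i ω)
    (a₀ a₁ a₂ : (i : Fin n) → ({j : Fin n // j ≠ i} → ℝ) → ℝ)
    (hmeas₀ : ∀ i, Measurable (a₀ i)) (hmeas₁ : ∀ i, Measurable (a₁ i))
    (hmeas₂ : ∀ i, Measurable (a₂ i))
    (hbdd₀ : ∀ i, ∃ C, ∀ v, |a₀ i v| ≤ C)
    (hbdd₁ : ∀ i, ∃ C, ∀ v, |a₁ i v| ≤ C)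
    (hbdd₂ : ∀ i, ∃ C, ∀ v, |a₂ i v| ≤ C)
    (Xhat : Ω → Fin n → ℝ)
    (hXhat : ∀ ω i, Xhat ω i
      = a₂ i (fun j => Z ω j.1) * (Z ω i) ^ 2
        + a₁ i (fun j => Z ω j.1) * Z ω i + a₀ i (fun j => Z ω j.1))
    (hint1 : ∀ i, Integrable (fun ω => (Z ω i - Xhat ω i) ^ 2) μ)
    (hint2 : ∀ i, Integrable (fun ω => (x i - Xhat ω i) ^ 2) μ) :
    ∫ ω, ((1 / (n : ℝ)) * ∑ i, (Z ω i - Xhat ω i) ^ 2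
        + σ ^ 2 / (n : ℝ) * ∑ i, (2 * a₁ i (fun j => Z ω j.1)
            + 4 * a₂ i (fun j => Z ω j.1) * Z ω i - 1)) ∂μ
      = ∫ ω, (1 / (n : ℝ)) * ∑ i, (x i - Xhat ω i) ^ 2 ∂μ := by
  have h2 := hN2int
  have hN1 : ∀ i, Integrable (N i) μ := by
    intro i
    refine ((integrable_const (1 : ℝ)).add (h2 i)).mono' (hNmeas i).aestronglyMeasurable ?_
    refine Filter.Eventually.of_forall fun ω => ?_
    simp only [Real.norm_eq_abs, Pi.add_apply]
    nlinarith [sq_abs (N i ω), sq_nonneg (|N i ω| - 1), abs_nonneg (N i ω)]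
  have h3 : ∀ i, Integrable (fun ω => (N i ω) ^ 3) μ := by
    intro i
    refine (hN3int i).mono' ((hNmeas i).pow_const 3).aestronglyMeasurable ?_
    exact Filter.Eventually.of_forall fun ω => by simp
  have h30 : ∀ i, ∫ ω, (N i ω) ^ 3 ∂μ = 0 := by
    intro i
    have e1 : ∫ y, y ^ 3 ∂(Measure.map (N i) μ) = ∫ ω, (N i ω) ^ 3 ∂μ :=
      integral_map (hNmeas i).aemeasurable (by fun_prop)
    have e2 : ∫ y, y ^ 3 ∂(Measure.map (fun ω => - N i ω) μ) = ∫ ω, (- N i ω) ^ 3 ∂μ :=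
      integral_map (hNmeas i).neg.aemeasurable (by fun_prop)
    rw [← hsymm i, e1] at e2
    have e3 : ∫ ω, (- N i ω) ^ 3 ∂μ = - ∫ ω, (N i ω) ^ 3 ∂μ := by
      have e4 : ∀ ω, (- N i ω) ^ 3 = - (N i ω) ^ 3 := fun ω => by ring
      simp only [e4, integral_neg]
    linarith
  -- cubic polynomials in the noise
  have poly : ∀ i (c0 c1 c2 c3 : ℝ),
      Integrable (fun ω => c0 + c1 * N i ω + c2 * N i ω ^ 2 + c3 * N i ω ^ 3) μ ∧
      ∫ ω, (c0 + c1 * N i ω + c2 * N i ω ^ 2 + c3 * N i ω ^ 3) ∂μ = c0 + c2 * σ ^ 2 := by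
    intro i c0 c1 c2 c3
    have i0 : Integrable (fun _ : Ω => c0) μ := integrable_const _
    have i1 := (hN1 i).const_mul c1
    have i2 := (h2 i).const_mul c2
    have i3 := (h3 i).const_mul c3
    have i01 : Integrable (fun ω => c0 + c1 * N i ω) μ := i0.add i1
    have i012 : Integrable (fun ω => c0 + c1 * N i ω + c2 * N i ω ^ 2) μ := i01.add i2
    refine ⟨i012.add i3, ?_⟩
    rw [integral_add i012 i3, integral_add i01 i2, integral_add i0 i1, integral_const_mul,
      integral_const_mul, integral_const_mul, hmean, hvar, h30]
    simp
  have zero : ∀ i (a : ({j : Fin n // j ≠ i} → ℝ) → ℝ), Measurable a → (∃ C, ∀ v, |a v| ≤ C) →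
      ∀ c0 c1 c2 c3 : ℝ, c0 + c2 * σ ^ 2 = 0 →
      Integrable (fun ω => a (fun j => Z ω j.1) *
        (c0 + c1 * N i ω + c2 * N i ω ^ 2 + c3 * N i ω ^ 3)) μ ∧
      ∫ ω, a (fun j => Z ω j.1) *
        (c0 + c1 * N i ω + c2 * N i ω ^ 2 + c3 * N i ω ^ 3) ∂μ = 0 := by
    intro i a ha ⟨C, hC⟩ c0 c1 c2 c3 hc
    simp only [hZ]
    exact indep_aux μ n x N hNmeas hindep i a ha C hC
      (fun y => c0 + c1 * y + c2 * y ^ 2 + c3 * y ^ 3) (by fun_prop) (poly i c0 c1 c2 c3).1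
      ((poly i c0 c1 c2 c3).2.trans hc)
  -- the difference of the two losses at pixel `i`
  have key : ∀ i, Integrable (fun ω => (Z ω i - Xhat ω i) ^ 2
        + σ ^ 2 * (2 * a₁ i (fun j => Z ω j.1) + 4 * a₂ i (fun j => Z ω j.1) * Z ω i - 1)
        - (x i - Xhat ω i) ^ 2) μ ∧
      ∫ ω, ((Z ω i - Xhat ω i) ^ 2
        + σ ^ 2 * (2 * a₁ i (fun j => Z ω j.1) + 4 * a₂ i (fun j => Z ω j.1) * Z ω i - 1)
        - (x i - Xhat ω i) ^ 2) ∂μ = 0 := by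
    intro i
    obtain ⟨I2, J2⟩ := zero i (a₂ i) (hmeas₂ i) (hbdd₂ i) (4 * σ ^ 2 * x i)
      (4 * σ ^ 2 - 2 * x i ^ 2) (-4 * x i) (-2) (by ring)
    obtain ⟨I1, J1⟩ := zero i (a₁ i) (hmeas₁ i) (hbdd₁ i) (2 * σ ^ 2) (-2 * x i) (-2) 0 (by ring)
    obtain ⟨I0, J0⟩ := zero i (a₀ i) (hmeas₀ i) (hbdd₀ i) 0 (-2) 0 0 (by ring)
    obtain ⟨I, J⟩ := poly i (-σ ^ 2) (2 * x i) 1 0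
    have e : (fun ω => (Z ω i - Xhat ω i) ^ 2
        + σ ^ 2 * (2 * a₁ i (fun j => Z ω j.1) + 4 * a₂ i (fun j => Z ω j.1) * Z ω i - 1)
        - (x i - Xhat ω i) ^ 2) =
        (fun ω => a₂ i (fun j => Z ω j.1) * (4 * σ ^ 2 * x i +
          (4 * σ ^ 2 - 2 * x i ^ 2) * N i ω + (-4 * x i) * N i ω ^ 2 + (-2) * N i ω ^ 3))
        + (fun ω => a₁ i (fun j => Z ω j.1) * (2 * σ ^ 2 +
          (-2 * x i) * N i ω + (-2) * N i ω ^ 2 + 0 * N i ω ^ 3))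
        + (fun ω => a₀ i (fun j => Z ω j.1) * (0 +
          (-2) * N i ω + 0 * N i ω ^ 2 + 0 * N i ω ^ 3))
        + (fun ω => -σ ^ 2 + (2 * x i) * N i ω + 1 * N i ω ^ 2 + 0 * N i ω ^ 3) := by
      · ext ω
        simp only [Pi.add_apply]
        rw [hXhat ω i]
        have hz := hZ ω i
        generalize a₂ i (fun j => Z ω j.1) = A2
        generalize a₁ i (fun j => Z ω j.1) = A1
        generalize a₀ i (fun j => Z ω j.1) = A0
        rw [hz]
        ring
    rw [e]
    refine ⟨((I2.add I1).add I0).add I, ?_⟩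
    rw [integral_add' ((I2.add I1).add I0) I, integral_add' (I2.add I1) I0, integral_add' I2 I1,
      J2, J1, J0, J]
    ring
  have hR : Integrable (fun ω => (1 / (n : ℝ)) * ∑ i, (x i - Xhat ω i) ^ 2) μ :=
    (integrable_finsetSum _ fun i _ => hint2 i).const_mul _
  have hD : Integrable (fun ω => (1 / (n : ℝ)) * ∑ i, ((Z ω i - Xhat ω i) ^ 2
        + σ ^ 2 * (2 * a₁ i (fun j => Z ω j.1) + 4 * a₂ i (fun j => Z ω j.1) * Z ω i - 1)
        - (x i - Xhat ω i) ^ 2)) μ :=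
    (integrable_finsetSum _ fun i _ => (key i).1).const_mul _
  have hD0 : ∫ ω, (1 / (n : ℝ)) * ∑ i, ((Z ω i - Xhat ω i) ^ 2
        + σ ^ 2 * (2 * a₁ i (fun j => Z ω j.1) + 4 * a₂ i (fun j => Z ω j.1) * Z ω i - 1)
        - (x i - Xhat ω i) ^ 2) ∂μ = 0 := by
    rw [integral_const_mul, integral_finsetSum _ fun i _ => (key i).1,
      Finset.sum_eq_zero fun i _ => (key i).2, mul_zero]
  rw [← add_zero (∫ ω, (1 / (n : ℝ)) * ∑ i, (x i - Xhat ω i) ^ 2 ∂μ), ← hD0,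
    ← integral_add hR hD]
  congr 1
  ext ω
  have hs : ∀ A B C : Fin n → ℝ, ∑ i, (A i + σ ^ 2 * B i - C i)
      = ∑ i, A i + σ ^ 2 * ∑ i, B i - ∑ i, C i := by
    intro A B C
    rw [Finset.sum_sub_distrib, Finset.sum_add_distrib, ← Finset.mul_sum]
  rw [hs (fun i => (Z ω i - Xhat ω i) ^ 2)
    (fun i => 2 * a₁ i (fun j => Z ω j.1) + 4 * a₂ i (fun j => Z ω j.1) * Z ω i - 1)
    (fun i => (x i - Xhat ω i) ^ 2)]
  generalize ∑ i, (Z ω i - Xhat ω i) ^ 2 = S1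
  generalize ∑ i, (2 * a₁ i (fun j => Z ω j.1) + 4 * a₂ i (fun j => Z ω j.1) * Z ω i - 1) = S2
  generalize ∑ i, (x i - Xhat ω i) ^ 2 = S3
  ring
end

section
/- Let n ≥ 1, let x ∈ ℝⁿ be a fixed (deterministic) clean image, and let N = (N₁,…,Nₙ) be a random vector with independent coordinates satisfying E[Nᵢ] = 0, E[Nᵢ²] = σ² (σ > 0), E[|Nᵢ|³] < ∞, and E[Nᵢ³] = 0 for every i (vanishing third moments; in particular no symmetry of the distribution is required). Set Z = x + N and let X̂ᵢ(Z) = a₂(Z^{-i})·Zᵢ² + a₁(Z^{-i})·Zᵢ + a₀(Z^{-i}) with a₀, a₁, a₂ bounded measurable functions of the coordinates of Z other than i. Then E[ (1/n)‖Z − X̂(Z)‖² + (σ²/n)·Σᵢ (2·a₁(Z^{-i}) + 4·a₂(Z^{-i})·Zᵢ − 1) ] = E[ (1/n)‖x − X̂(Z)‖² ]. -/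
open MeasureTheory ProbabilityTheory

/-- Integrable with zero mean. -/
def QZeroMean {Ω : Type*} [MeasurableSpace Ω] (μ : Measure Ω) (f : Ω → ℝ) : Prop :=
  Integrable f μ ∧ ∫ ω, f ω ∂μ = 0

lemma QZeroMean.add {Ω : Type*} [MeasurableSpace Ω] {μ : Measure Ω} {f g : Ω → ℝ}
    (hf : QZeroMean μ f) (hg : QZeroMean μ g) : QZeroMean μ (fun ω => f ω + g ω) :=
  ⟨hf.1.add hg.1, by rw [integral_add hf.1 hg.1, hf.2, hg.2, add_zero]⟩

lemma QZeroMean.const_mul {Ω : Type*} [MeasurableSpace Ω] {μ : Measure Ω} {f : Ω → ℝ}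
    (hf : QZeroMean μ f) (c : ℝ) : QZeroMean μ (fun ω => c * f ω) :=
  ⟨hf.1.const_mul c, by rw [integral_const_mul, hf.2, mul_zero]⟩

lemma QZeroMean.sum {Ω : Type*} [MeasurableSpace Ω] {μ : Measure Ω} {n : ℕ} {f : Fin n → Ω → ℝ}
    (hf : ∀ i, QZeroMean μ (f i)) : QZeroMean μ (fun ω => ∑ i, f i ω) :=
  ⟨integrable_finsetSum _ fun i _ => (hf i).1, by
    rw [integral_finsetSum _ fun i _ => (hf i).1]
    exact Finset.sum_eq_zero fun i _ => (hf i).2⟩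

lemma qZeroMean_mul {Ω : Type*} [MeasurableSpace Ω] (μ : Measure Ω) [IsProbabilityMeasure μ]
    (n : ℕ) (x : Fin n → ℝ) (N : Fin n → Ω → ℝ)
    (hNmeas : ∀ i, Measurable (N i)) (hindep : iIndepFun N μ)
    (i : Fin n) (a : ({j : Fin n // j ≠ i} → ℝ) → ℝ) (ha : Measurable a)
    (hb : ∃ C, ∀ v, |a v| ≤ C) (g : ℝ → ℝ) (hg : Measurable g)
    (h : QZeroMean μ (fun ω => g (N i ω))) :
    QZeroMean μ (fun ω => a (fun j => x j.1 + N j.1 ω) * g (N i ω)) := by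
  obtain ⟨C, hC⟩ := hb
  have hA : Measurable (fun ω => a (fun j => x j.1 + N j.1 ω)) :=
    ha.comp (measurable_pi_lambda _ fun j => measurable_const.add (hNmeas _))
  have hI := hindep.indepFun_finset (Finset.univ.filter (· ≠ i)) {i}
    (by simp) hNmeas
  have hI2 : IndepFun (fun ω => a (fun j => x j.1 + N j.1 ω)) (fun ω => g (N i ω)) μ := by
    have hφ : Measurable (fun v : (Finset.univ.filter (· ≠ i) : Finset (Fin n)) → ℝ =>
        a (fun j => x j.1 + v ⟨j.1, by simpa using j.2⟩)) :=
      ha.comp (measurable_pi_lambda _ fun j => measurable_const.add (measurable_pi_apply _))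
    have hψ : Measurable (fun v : ({i} : Finset (Fin n)) → ℝ => g (v ⟨i, by simp⟩)) :=
      hg.comp (measurable_pi_apply _)
    exact hI.comp hφ hψ
  refine ⟨h.1.bdd_mul hA.aestronglyMeasurable (c := C) (ae_of_all _ fun ω => hC _), ?_⟩
  rw [hI2.integral_fun_mul_eq_mul_integral hA.aestronglyMeasurable h.1.aestronglyMeasurable,
    h.2, mul_zero]

/-- unbiasedness of the estimated loss for second-order (`d = 2`)
polynomial pixelwise denoisers, under independent, zero-mean, variance-`σ²`,
noise coordinates with finite third absolute moments and vanishing third moments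
(no symmetry of the distribution is required).
For `Z = x + N` and `X̂ᵢ(Z) = a₂(Z^{-i})Zᵢ² + a₁(Z^{-i})Zᵢ + a₀(Z^{-i})`,
`E[(1/n)‖Z − X̂(Z)‖² + (σ²/n)Σᵢ(2a₁(Z^{-i}) + 4a₂(Z^{-i})Zᵢ − 1)]
   = E[(1/n)‖x − X̂(Z)‖²]`. -/
theorem quadratic_estimated_loss_unbiased_third_moment
    {Ω : Type*} [MeasurableSpace Ω] (μ : Measure Ω) [IsProbabilityMeasure μ]
    (n : ℕ) (hn : 1 ≤ n) (x : Fin n → ℝ) (σ : ℝ) (hσ : 0 < σ)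
    (N : Fin n → Ω → ℝ)
    (hNmeas : ∀ i, Measurable (N i))
    (hindep : iIndepFun N μ)
    (hmean : ∀ i, ∫ ω, N i ω ∂μ = 0)
    (hvar : ∀ i, ∫ ω, (N i ω) ^ 2 ∂μ = σ ^ 2)
    (hN2int : ∀ i, Integrable (fun ω => (N i ω) ^ 2) μ)
    (hN3int : ∀ i, Integrable (fun ω => |N i ω| ^ 3) μ)
    (hthird : ∀ i, ∫ ω, (N i ω) ^ 3 ∂μ = 0)
    (Z : Ω → Fin n → ℝ) (hZ : ∀ ω i, Z ω i = x i + N i ω)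
    (a₀ a₁ a₂ : (i : Fin n) → ({j : Fin n // j ≠ i} → ℝ) → ℝ)
    (hmeas₀ : ∀ i, Measurable (a₀ i)) (hmeas₁ : ∀ i, Measurable (a₁ i))
    (hmeas₂ : ∀ i, Measurable (a₂ i))
    (hbdd₀ : ∀ i, ∃ C, ∀ v, |a₀ i v| ≤ C)
    (hbdd₁ : ∀ i, ∃ C, ∀ v, |a₁ i v| ≤ C)
    (hbdd₂ : ∀ i, ∃ C, ∀ v, |a₂ i v| ≤ C)
    (Xhat : Ω → Fin n → ℝ)
    (hXhat : ∀ ω i, Xhat ω i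
      = a₂ i (fun j => Z ω j.1) * (Z ω i) ^ 2
        + a₁ i (fun j => Z ω j.1) * Z ω i + a₀ i (fun j => Z ω j.1))
    (hint1 : ∀ i, Integrable (fun ω => (Z ω i - Xhat ω i) ^ 2) μ)
    (hint2 : ∀ i, Integrable (fun ω => (x i - Xhat ω i) ^ 2) μ) :
    ∫ ω, ((1 / (n : ℝ)) * ∑ i, (Z ω i - Xhat ω i) ^ 2
        + σ ^ 2 / (n : ℝ) * ∑ i, (2 * a₁ i (fun j => Z ω j.1)
            + 4 * a₂ i (fun j => Z ω j.1) * Z ω i - 1)) ∂μ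
      = ∫ ω, (1 / (n : ℝ)) * ∑ i, (x i - Xhat ω i) ^ 2 ∂μ := by
  have hN1 : ∀ i, Integrable (N i) μ := fun i =>
    ((memLp_two_iff_integrable_sq (hNmeas i).aestronglyMeasurable).2 (hN2int i)).integrable
      (by norm_num)
  have hN3 : ∀ i, Integrable (fun ω => N i ω ^ 3) μ := fun i => by
    refine (hN3int i).mono ((hNmeas i).pow_const 3).aestronglyMeasurable (ae_of_all _ fun ω => ?_)
    simp
  have z1 : ∀ i, QZeroMean μ (fun ω => N i ω) := fun i => ⟨hN1 i, hmean i⟩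
  have z2 : ∀ i, QZeroMean μ (fun ω => N i ω ^ 2 - σ ^ 2) := fun i =>
    ⟨(hN2int i).sub (integrable_const _), by
      rw [integral_sub (hN2int i) (integrable_const _), hvar i]; simp⟩
  have z3 : ∀ i, QZeroMean μ (fun ω => N i ω ^ 3) := fun i => ⟨hN3 i, hthird i⟩
  have key := fun i a ha hb => qZeroMean_mul μ n x N hNmeas hindep i a ha hb
  have m1 : Measurable (fun t : ℝ => t) := measurable_id
  have m2 : Measurable (fun t : ℝ => t ^ 2 - σ ^ 2) := by fun_prop
  have m3 : Measurable (fun t : ℝ => t ^ 3) := by fun_prop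
  have D : ∀ i, QZeroMean μ (fun ω => (Z ω i - Xhat ω i) ^ 2 - (x i - Xhat ω i) ^ 2
      + σ ^ 2 * (2 * a₁ i (fun j => Z ω j.1) + 4 * a₂ i (fun j => Z ω j.1) * Z ω i - 1)) := by
    intro i
    have t01 := key i _ (hmeas₀ i) (hbdd₀ i) _ m1 (z1 i)
    have t11 := key i _ (hmeas₁ i) (hbdd₁ i) _ m1 (z1 i)
    have t12 := key i _ (hmeas₁ i) (hbdd₁ i) _ m2 (z2 i)
    have t21 := key i _ (hmeas₂ i) (hbdd₂ i) _ m1 (z1 i)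
    have t22 := key i _ (hmeas₂ i) (hbdd₂ i) _ m2 (z2 i)
    have t23 := key i _ (hmeas₂ i) (hbdd₂ i) _ m3 (z3 i)
    have T := ((((((z2 i).add ((z1 i).const_mul (2 * x i))).add
      (t01.const_mul (-2))).add (t11.const_mul (-2 * x i))).add (t12.const_mul (-2))).add
      (t21.const_mul (4 * σ ^ 2 - 2 * x i ^ 2))).add
      ((t22.const_mul (-4 * x i)).add (t23.const_mul (-2)))
    convert T using 2 with ω
    simp only [hXhat, hZ]
    ring
  have S := (QZeroMean.sum D).const_mul (1 / (n : ℝ))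
  have hR : Integrable (fun ω => (1 / (n : ℝ)) * ∑ i, (x i - Xhat ω i) ^ 2) μ :=
    (integrable_finsetSum _ fun i _ => hint2 i).const_mul _
  rw [← zero_add (∫ ω, (1 / (n : ℝ)) * ∑ i, (x i - Xhat ω i) ^ 2 ∂μ), ← S.2,
    ← integral_add S.1 hR]
  congr 1
  ext ω
  simp only [Finset.sum_add_distrib, Finset.sum_sub_distrib, ← Finset.mul_sum]
  ring
end

section
/- Let n ≥ 1, x ∈ ℝⁿ deterministic, and N = (N₁,…,Nₙ) a random vector with independent coordinates, E[Nᵢ] = 0, E[Nᵢ²] = σ² (σ > 0), E[|Nᵢ|³] < ∞ and E[Nᵢ³] = 0. Set Z = x + N and fix a pixel index i. Let X̂ᵢ = a₂(Z^{-i})·Zᵢ² + a₁(Z^{-i})·Zᵢ + a₀(Z^{-i}) with a₀, a₁, a₂ bounded measurable functions of the coordinates of Z other than i. Then the per-pixel unbiasedness identity holds: E[ (Zᵢ − X̂ᵢ)² + σ²·(2·a₁(Z^{-i}) + 4·a₂(Z^{-i})·Zᵢ − 1) ] = E[ (xᵢ − X̂ᵢ)² ]. -/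
open MeasureTheory ProbabilityTheory

/-- per-pixel unbiasedness identity for second-order polynomial pixelwise
denoisers. With independent, zero-mean, variance-`σ²` noise coordinates with finite third
absolute moments and vanishing third moments, `Z = x + N`, a fixed pixel `i`, and
`X̂ᵢ = a₂(Z^{-i})Zᵢ² + a₁(Z^{-i})Zᵢ + a₀(Z^{-i})`,
`E[(Zᵢ − X̂ᵢ)² + σ²(2a₁(Z^{-i}) + 4a₂(Z^{-i})Zᵢ − 1)] = E[(xᵢ − X̂ᵢ)²]`. -/
theorem per_pixel_unbiased_quadratic
    {Ω : Type*} [MeasurableSpace Ω] (μ : Measure Ω) [IsProbabilityMeasure μ]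
    (n : ℕ) (hn : 1 ≤ n) (x : Fin n → ℝ) (σ : ℝ) (hσ : 0 < σ)
    (N : Fin n → Ω → ℝ)
    (hNmeas : ∀ i, Measurable (N i))
    (hindep : iIndepFun N μ)
    (hmean : ∀ i, ∫ ω, N i ω ∂μ = 0)
    (hvar : ∀ i, ∫ ω, (N i ω) ^ 2 ∂μ = σ ^ 2)
    (hN2int : ∀ i, Integrable (fun ω => (N i ω) ^ 2) μ)
    (hN3int : ∀ i, Integrable (fun ω => |N i ω| ^ 3) μ)
    (hthird : ∀ i, ∫ ω, (N i ω) ^ 3 ∂μ = 0)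
    (Z : Ω → Fin n → ℝ) (hZ : ∀ ω i, Z ω i = x i + N i ω)
    (i : Fin n)
    (a₀ a₁ a₂ : ({j : Fin n // j ≠ i} → ℝ) → ℝ)
    (hmeas₀ : Measurable a₀) (hmeas₁ : Measurable a₁) (hmeas₂ : Measurable a₂)
    (hbdd₀ : ∃ C, ∀ v, |a₀ v| ≤ C)
    (hbdd₁ : ∃ C, ∀ v, |a₁ v| ≤ C)
    (hbdd₂ : ∃ C, ∀ v, |a₂ v| ≤ C)
    (Xhat : Ω → ℝ)
    (hXhat : ∀ ω, Xhat ω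
      = a₂ (fun j => Z ω j.1) * (Z ω i) ^ 2
        + a₁ (fun j => Z ω j.1) * Z ω i + a₀ (fun j => Z ω j.1))
    (hint1 : Integrable (fun ω => (Z ω i - Xhat ω) ^ 2) μ)
    (hint2 : Integrable (fun ω => (x i - Xhat ω) ^ 2) μ) :
    ∫ ω, ((Z ω i - Xhat ω) ^ 2
        + σ ^ 2 * (2 * a₁ (fun j => Z ω j.1)
            + 4 * a₂ (fun j => Z ω j.1) * Z ω i - 1)) ∂μ
      = ∫ ω, (x i - Xhat ω) ^ 2 ∂μ := by
  have hN1int : Integrable (N i) μ := by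
    refine ((hN2int i).add (integrable_const 1)).mono' (hNmeas i).aestronglyMeasurable ?_
    filter_upwards with ω
    simp only [Pi.add_apply, Real.norm_eq_abs]
    nlinarith [sq_nonneg (|N i ω| - 1), sq_abs (N i ω), abs_nonneg (N i ω)]
  have hN3 : Integrable (fun ω => (N i ω) ^ 3) μ := by
    refine (hN3int i).mono' ((hNmeas i).pow_const 3).aestronglyMeasurable ?_
    filter_upwards with ω
    simp
  have hV : IndepFun (fun ω (j : {j : Fin n // j ≠ i}) => Z ω j.1) (N i) μ := by
    have h := hindep.indepFun_finset (Finset.univ.erase i) {i} (by simp) hNmeas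
    have hψ : Measurable (fun (v : {k // k ∈ ({i} : Finset (Fin n))} → ℝ) =>
        v ⟨i, by simp⟩) := measurable_pi_apply _
    have h2 := h.comp
      (φ := fun (v : {k // k ∈ Finset.univ.erase i} → ℝ) (j : {j : Fin n // j ≠ i}) =>
        x j.1 + v ⟨j.1, by simp [j.2]⟩)
      (ψ := fun (v : {k // k ∈ ({i} : Finset (Fin n))} → ℝ) => v ⟨i, by simp⟩)
      (by fun_prop) hψ
    have e : (fun ω (j : {j : Fin n // j ≠ i}) => Z ω j.1)
        = fun ω (j : {j : Fin n // j ≠ i}) => x j.1 + N j.1 ω := by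
      funext ω j
      exact hZ ω j.1
    rw [e]
    exact h2
  have hVm : Measurable (fun ω (j : {j : Fin n // j ≠ i}) => Z ω j.1) := by
    simp only [hZ]
    fun_prop
  have key : ∀ (b : ({j : Fin n // j ≠ i} → ℝ) → ℝ) (p : ℝ → ℝ), Measurable b →
      (∃ C, ∀ v, |b v| ≤ C) → Measurable p → Integrable (fun ω => p (N i ω)) μ →
      ∫ ω, p (N i ω) ∂μ = 0 →
      Integrable (fun ω => b (fun j => Z ω j.1) * p (N i ω)) μ ∧
      ∫ ω, b (fun j => Z ω j.1) * p (N i ω) ∂μ = 0 := by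
    intro b p hb hC hp hpi hp0
    obtain ⟨C, hC⟩ := hC
    refine ⟨hpi.bdd_mul (c := C) (hb.comp hVm).aestronglyMeasurable
      (Filter.Eventually.of_forall fun ω => hC _), ?_⟩
    have h := (hV.comp hb hp).integral_fun_mul_eq_mul_integral
      (hb.comp hVm).aestronglyMeasurable (hp.comp (hNmeas i)).aestronglyMeasurable
    simp only [Function.comp_apply] at h
    rw [h, hp0, mul_zero]
  obtain ⟨C₀, hC₀⟩ := hbdd₀
  obtain ⟨C₁, hC₁⟩ := hbdd₁
  obtain ⟨C₂, hC₂⟩ := hbdd₂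
  have bd : ∀ c d e f : ℝ, ∃ C, ∀ v, |c + d * a₂ v + e * a₁ v + f * a₀ v| ≤ C := by
    intro c d e f
    refine ⟨|c| + |d| * C₂ + |e| * C₁ + |f| * C₀, fun v => ?_⟩
    refine (abs_add_le _ _).trans (add_le_add ((abs_add_le _ _).trans
      (add_le_add ((abs_add_le _ _).trans (add_le_add le_rfl ?_)) ?_)) ?_)
    all_goals rw [abs_mul]
    · exact mul_le_mul_of_nonneg_left (hC₂ v) (abs_nonneg _)
    · exact mul_le_mul_of_nonneg_left (hC₁ v) (abs_nonneg _)
    · exact mul_le_mul_of_nonneg_left (hC₀ v) (abs_nonneg _)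
  obtain ⟨i1, e1⟩ := key _ (fun t => t) (by fun_prop)
    (bd (2 * x i) (-2 * x i ^ 2 + 4 * σ ^ 2) (-2 * x i) (-2)) (by fun_prop) hN1int (hmean i)
  obtain ⟨i2, e2⟩ := key _ (fun t => t ^ 2 - σ ^ 2) (by fun_prop)
    (bd 1 (-4 * x i) (-2) 0) (by fun_prop) ((hN2int i).sub (integrable_const _))
    (by rw [integral_sub (hN2int i) (integrable_const _), hvar i]; simp)
  obtain ⟨i3, e3⟩ := key _ (fun t => t ^ 3) (by fun_prop)
    (bd 0 (-2) 0 0) (by fun_prop) hN3 (hthird i)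
  have h12 := integral_add i1 i2
  have h123 := integral_add (i1.add i2) i3
  have hall := integral_add hint2 ((i1.add i2).add i3)
  simp only [Pi.add_apply] at h12 h123 hall
  rw [h123, h12, e1, e2, e3, add_zero, add_zero, add_zero] at hall
  rw [← hall]
  refine integral_congr_ae (Filter.Eventually.of_forall fun ω => ?_)
  simp only [hXhat]
  generalize a₀ (fun j => Z ω j.1) = A
  generalize a₁ (fun j => Z ω j.1) = B
  generalize a₂ (fun j => Z ω j.1) = D
  rw [hZ ω i]
  ring
end

section
/- Let n ≥ 1, x ∈ ℝⁿ deterministic, and N = (N₁,…,Nₙ) a random vector with independent coordinates, E[Nᵢ] = 0 and E[Nᵢ²] = σ² (σ > 0). Set Z = x + N and fix a pixel index i. Let X̂ᵢ = a₁(Z^{-i})·Zᵢ + a₀(Z^{-i}) with a₀, a₁ bounded measurable functions of the coordinates of Z other than i. Then E[ (Zᵢ − X̂ᵢ)² + σ²·(2·a₁(Z^{-i}) − 1) ] = E[ (xᵢ − X̂ᵢ)² ]. -/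
open MeasureTheory ProbabilityTheory

/-- per-pixel unbiasedness identity for first-order (affine) polynomial
pixelwise denoisers. With independent, zero-mean, variance-`σ²` noise coordinates,
`Z = x + N`, a fixed pixel `i`, and `X̂ᵢ = a₁(Z^{-i})Zᵢ + a₀(Z^{-i})`,
`E[(Zᵢ − X̂ᵢ)² + σ²(2a₁(Z^{-i}) − 1)] = E[(xᵢ − X̂ᵢ)²]`. -/
theorem per_pixel_unbiased_affine
    {Ω : Type*} [MeasurableSpace Ω] (μ : Measure Ω) [IsProbabilityMeasure μ]
    (n : ℕ) (hn : 1 ≤ n) (x : Fin n → ℝ) (σ : ℝ) (hσ : 0 < σ)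
    (N : Fin n → Ω → ℝ)
    (hNmeas : ∀ i, Measurable (N i))
    (hindep : iIndepFun N μ)
    (hmean : ∀ i, ∫ ω, N i ω ∂μ = 0)
    (hvar : ∀ i, ∫ ω, (N i ω) ^ 2 ∂μ = σ ^ 2)
    (hN2int : ∀ i, Integrable (fun ω => (N i ω) ^ 2) μ)
    (Z : Ω → Fin n → ℝ) (hZ : ∀ ω i, Z ω i = x i + N i ω)
    (i : Fin n)
    (a₀ a₁ : ({j : Fin n // j ≠ i} → ℝ) → ℝ)
    (hmeas₀ : Measurable a₀) (hmeas₁ : Measurable a₁)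
    (hbdd₀ : ∃ C, ∀ v, |a₀ v| ≤ C)
    (hbdd₁ : ∃ C, ∀ v, |a₁ v| ≤ C)
    (Xhat : Ω → ℝ)
    (hXhat : ∀ ω, Xhat ω
      = a₁ (fun j => Z ω j.1) * Z ω i + a₀ (fun j => Z ω j.1)) :
    ∫ ω, ((Z ω i - Xhat ω) ^ 2 + σ ^ 2 * (2 * a₁ (fun j => Z ω j.1) - 1)) ∂μ
      = ∫ ω, (x i - Xhat ω) ^ 2 ∂μ := by
  obtain ⟨C₀, hC₀⟩ := hbdd₀
  obtain ⟨C₁, hC₁⟩ := hbdd₁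
  have hindep2 : IndepFun (fun ω (j : {j : Fin n // j ≠ i}) => Z ω j.1) (N i) μ := by
    have h := hindep.indepFun_finset (Finset.univ.erase i) {i} (by simp) hNmeas
    have hφ : Measurable (fun (v : ↥(Finset.univ.erase i : Finset (Fin n)) → ℝ)
        (j : {j : Fin n // j ≠ i}) => x j.1 + v ⟨j.1, by simp [j.2]⟩) := by fun_prop
    have hψ : Measurable (fun (v : ↥({i} : Finset (Fin n)) → ℝ) => v ⟨i, by simp⟩) := by fun_prop
    have h2 := h.comp hφ hψ
    convert h2 using 1
    · funext ω j
      simp [hZ]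
    · rfl
  have hVm : Measurable (fun ω (j : {j : Fin n // j ≠ i}) => Z ω j.1) := by
    simp only [hZ]
    fun_prop
  set V : Ω → {j : Fin n // j ≠ i} → ℝ := fun ω j => Z ω j.1 with hV
  have hV' : ∀ ω, (fun j : {j : Fin n // j ≠ i} => Z ω j.1) = V ω := fun ω => rfl
  have hWL : MemLp (N i) 2 μ :=
    (memLp_two_iff_integrable_sq (hNmeas i).aestronglyMeasurable).2 (hN2int i)
  have hW : Integrable (N i) μ := hWL.integrable (by norm_num)
  have hb : ∀ (g : ({j : Fin n // j ≠ i} → ℝ) → ℝ), Measurable g → ∀ C, (∀ v, |g v| ≤ C) →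
      ∀ f : Ω → ℝ, Integrable f μ → Integrable (fun ω => g (V ω) * f ω) μ := by
    intro g hg C hC f hf
    exact hf.bdd_mul (c := C) (hg.comp hVm).aestronglyMeasurable
      (Filter.Eventually.of_forall fun ω => by simpa using hC (V ω))
  have hz : ∀ (g : ({j : Fin n // j ≠ i} → ℝ) → ℝ), Measurable g →
      ∀ k : ℝ → ℝ, Measurable k → ∫ ω, k (N i ω) ∂μ = 0 →
      ∫ ω, g (V ω) * k (N i ω) ∂μ = 0 := by
    intro g hg k hk h0
    have h := (hindep2.comp hg hk).integral_fun_mul_eq_mul_integral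
      (hg.comp hVm).aestronglyMeasurable (hk.comp (hNmeas i)).aestronglyMeasurable
    simp only [Function.comp_apply] at h
    rw [h, h0, mul_zero]
  set G : ({j : Fin n // j ≠ i} → ℝ) → ℝ := fun v => 1 - 2 * a₁ v with hG
  set c : ({j : Fin n // j ≠ i} → ℝ) → ℝ := fun v => x i - a₁ v * x i - a₀ v with hc
  have hGm : Measurable G := by fun_prop
  have hcm : Measurable c := by fun_prop
  have hGb : ∀ v, |G v| ≤ 1 + 2 * C₁ := by
    intro v
    have := abs_le.1 (hC₁ v)
    exact abs_le.2 ⟨by simp only [hG]; linarith, by simp only [hG]; linarith⟩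
  have hcb : ∀ v, |c v| ≤ |x i| + C₁ * |x i| + C₀ := by
    intro v
    have h1 := abs_sub (x i - a₁ v * x i) (a₀ v)
    have h2 := abs_sub (x i) (a₁ v * x i)
    rw [abs_mul] at h2
    have h3 := mul_le_mul_of_nonneg_right (hC₁ v) (abs_nonneg (x i))
    have h4 := hC₀ v
    simp only [hc]
    linarith
  have hW2 : Integrable (fun ω => (N i ω) ^ 2 - σ ^ 2) μ := (hN2int i).sub (integrable_const _)
  have i1 := hb G hGm _ hGb _ hW2
  have i2 := (hb c hcm _ hcb _ hW).const_mul 2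
  have j1 := hb c hcm _ hcb _ (by simpa using hb c hcm _ hcb _ (integrable_const (1:ℝ)))
  have j2 := (hb c hcm _ hcb _ (hb a₁ hmeas₁ _ hC₁ _ hW)).const_mul 2
  have j3 := hb a₁ hmeas₁ _ hC₁ _ (hb a₁ hmeas₁ _ hC₁ _ (hN2int i))
  have i3 : Integrable (fun ω => (x i - Xhat ω) ^ 2) μ := by
    refine ((j1.sub j2).add j3).congr (Filter.Eventually.of_forall fun ω => ?_)
    simp only [Pi.add_apply, Pi.sub_apply, hXhat, hZ ω i, hc, hV']
    ring
  have z1 : ∫ ω, G (V ω) * ((N i ω) ^ 2 - σ ^ 2) ∂μ = 0 := by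
    refine hz G hGm (fun t => t ^ 2 - σ ^ 2) (by fun_prop) ?_
    rw [integral_sub (hN2int i) (integrable_const _), hvar]
    simp
  have z2 : ∫ ω, 2 * (c (V ω) * N i ω) ∂μ = 0 := by
    rw [integral_const_mul, hz c hcm (fun t => t) measurable_id (hmean i), mul_zero]
  have e : ∀ ω, ((Z ω i - Xhat ω) ^ 2 + σ ^ 2 * (2 * a₁ (V ω) - 1))
      = (x i - Xhat ω) ^ 2 + (G (V ω) * ((N i ω) ^ 2 - σ ^ 2) + 2 * (c (V ω) * N i ω)) := by
    intro ω
    simp only [hXhat, hZ ω i, hc, hG, hV']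
    ring
  refine (integral_congr_ae (Filter.Eventually.of_forall e)).trans ?_
  have i12 : Integrable (fun ω => G (V ω) * ((N i ω) ^ 2 - σ ^ 2) + 2 * (c (V ω) * N i ω)) μ :=
    i1.add i2
  rw [integral_add i3 i12, integral_add i1 i2, z1, z2]
  simp
end

section
/- Let n ≥ 1, x ∈ ℝⁿ deterministic, and N = (N₁,…,Nₙ) a random vector with independent coordinates, E[Nᵢ] = 0, E[Nᵢ²] = σ² (σ > 0), E[|Nᵢ|³] < ∞ and E[Nᵢ³] = 0. Set Z = x + N, fix a pixel index i, and let X̂ᵢ = a₂(Z^{-i})·Zᵢ² + a₁(Z^{-i})·Zᵢ + a₀(Z^{-i}) with a₀, a₁, a₂ bounded measurable functions of the coordinates of Z other than i. Then, almost surely, the conditional expectations given the σ-algebra generated by Z^{-i} satisfy E[ (Zᵢ − X̂ᵢ)² + σ²·(2·a₁(Z^{-i}) + 4·a₂(Z^{-i})·Zᵢ − 1) | σ(Z^{-i}) ] = E[ (xᵢ − X̂ᵢ)² | σ(Z^{-i}) ]. -/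
open MeasureTheory ProbabilityTheory

theorem condExp_mul_eq_zero_of_indep_aux
    {Ω β : Type*} [m0 : MeasurableSpace Ω] [mb : MeasurableSpace β] (μ : Measure Ω)
    [IsProbabilityMeasure μ]
    (V : Ω → β) (hV : Measurable V) (Y : Ω → ℝ) (hY : Measurable Y) (hYV : IndepFun Y V μ)
    (g : ℝ → ℝ) (hg : Measurable g) (hgi : Integrable (fun ω => g (Y ω)) μ)
    (hg0 : ∫ ω, g (Y ω) ∂μ = 0)
    (c : β → ℝ) (hc : Measurable c) (hcb : ∃ C, ∀ v, |c v| ≤ C) :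
    Integrable (fun ω => c (V ω) * g (Y ω)) μ ∧
    μ[fun ω => c (V ω) * g (Y ω) | MeasurableSpace.comap V mb] =ᵐ[μ] fun _ => (0 : ℝ) := by
  obtain ⟨C, hC⟩ := hcb
  have hi : Integrable (fun ω => c (V ω) * g (Y ω)) μ :=
    hgi.bdd_mul (hc.comp hV).aestronglyMeasurable (Filter.Eventually.of_forall fun ω => hC (V ω))
  refine ⟨hi, ?_⟩
  have hcm : StronglyMeasurable[MeasurableSpace.comap V mb] (fun ω => c (V ω)) :=
    (hc.comp (comap_measurable V)).stronglyMeasurable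
  have h1 := condExp_mul_of_stronglyMeasurable_left (μ := μ) hcm hi hgi
  have hgm : StronglyMeasurable[MeasurableSpace.comap Y inferInstance] (fun ω => g (Y ω)) :=
    (hg.comp (comap_measurable Y)).stronglyMeasurable
  have h2 := condExp_indep_eq (μ := μ) hY.comap_le hV.comap_le hgm hYV
  refine h1.trans ?_
  filter_upwards [h2] with ω h
  rw [Pi.mul_apply, h, hg0, mul_zero]

/-- conditional per-pixel unbiasedness. With independent, zero-mean,
variance-`σ²` noise coordinates with finite third absolute moments and vanishing third
moments, `Z = x + N`, a fixed pixel `i`, and the second-order polynomial pixelwise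
denoiser `X̂ᵢ = a₂(Z^{-i})Zᵢ² + a₁(Z^{-i})Zᵢ + a₀(Z^{-i})`, the conditional expectations
given the σ-algebra generated by `Z^{-i}` satisfy, almost surely,
`E[(Zᵢ − X̂ᵢ)² + σ²(2a₁(Z^{-i}) + 4a₂(Z^{-i})Zᵢ − 1) | σ(Z^{-i})]
   = E[(xᵢ − X̂ᵢ)² | σ(Z^{-i})]`. -/
theorem per_pixel_unbiased_quadratic_conditional
    {Ω : Type*} [MeasurableSpace Ω] (μ : Measure Ω) [IsProbabilityMeasure μ]
    (n : ℕ) (hn : 1 ≤ n) (x : Fin n → ℝ) (σ : ℝ) (hσ : 0 < σ)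
    (N : Fin n → Ω → ℝ)
    (hNmeas : ∀ i, Measurable (N i))
    (hindep : iIndepFun N μ)
    (hmean : ∀ i, ∫ ω, N i ω ∂μ = 0)
    (hvar : ∀ i, ∫ ω, (N i ω) ^ 2 ∂μ = σ ^ 2)
    (hN2int : ∀ i, Integrable (fun ω => (N i ω) ^ 2) μ)
    (hN3int : ∀ i, Integrable (fun ω => |N i ω| ^ 3) μ)
    (hthird : ∀ i, ∫ ω, (N i ω) ^ 3 ∂μ = 0)
    (Z : Ω → Fin n → ℝ) (hZ : ∀ ω i, Z ω i = x i + N i ω)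
    (i : Fin n)
    (a₀ a₁ a₂ : ({j : Fin n // j ≠ i} → ℝ) → ℝ)
    (hmeas₀ : Measurable a₀) (hmeas₁ : Measurable a₁) (hmeas₂ : Measurable a₂)
    (hbdd₀ : ∃ C, ∀ v, |a₀ v| ≤ C)
    (hbdd₁ : ∃ C, ∀ v, |a₁ v| ≤ C)
    (hbdd₂ : ∃ C, ∀ v, |a₂ v| ≤ C)
    (Xhat : Ω → ℝ)
    (hXhat : ∀ ω, Xhat ω
      = a₂ (fun j => Z ω j.1) * (Z ω i) ^ 2
        + a₁ (fun j => Z ω j.1) * Z ω i + a₀ (fun j => Z ω j.1))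
    (hint1 : Integrable (fun ω => (Z ω i - Xhat ω) ^ 2) μ)
    (hint2 : Integrable (fun ω => (x i - Xhat ω) ^ 2) μ)
    (m : MeasurableSpace Ω)
    (hm : m = MeasurableSpace.comap
      (fun ω => (fun j : {j : Fin n // j ≠ i} => Z ω j.1)) inferInstance) :
    μ[fun ω => (Z ω i - Xhat ω) ^ 2
        + σ ^ 2 * (2 * a₁ (fun j => Z ω j.1)
            + 4 * a₂ (fun j => Z ω j.1) * Z ω i - 1) | m]
      =ᵐ[μ] μ[fun ω => (x i - Xhat ω) ^ 2 | m] := by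
  subst hm
  have hVmeas : Measurable (fun ω => (fun j : {j : Fin n // j ≠ i} => Z ω j.1)) := by
    refine measurable_pi_lambda _ fun j => ?_
    simp only [hZ]
    exact (hNmeas j.1).const_add _
  have hYV : IndepFun (N i) (fun ω => (fun j : {j : Fin n // j ≠ i} => Z ω j.1)) μ := by
    have h := hindep.indepFun_finset {i} (Finset.univ.erase i) (by simp) hNmeas
    have hφ : Measurable (fun v : ({i} : Finset (Fin n)) → ℝ =>
        v ⟨i, Finset.mem_singleton_self i⟩) := measurable_pi_apply _
    have hψ : Measurable (fun (v : ↥(Finset.univ.erase i : Finset (Fin n)) → ℝ)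
        (j : {j : Fin n // j ≠ i}) =>
        x j.1 + v ⟨j.1, Finset.mem_erase.2 ⟨j.2, Finset.mem_univ _⟩⟩) :=
      measurable_pi_lambda _ fun j => (measurable_pi_apply _).const_add _
    have h' := h.comp hφ hψ
    have e : (fun ω => (fun j : {j : Fin n // j ≠ i} => Z ω j.1))
        = (fun (v : ↥(Finset.univ.erase i : Finset (Fin n)) → ℝ) (j : {j : Fin n // j ≠ i}) => x j.1 + v ⟨j.1, Finset.mem_erase.2 ⟨j.2, Finset.mem_univ _⟩⟩) ∘
          (fun ω (j : (Finset.univ.erase i : Finset (Fin n))) => N j.1 ω) := by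
      funext ω j
      simp [hZ]
    rw [e]
    exact h'
  generalize hVdef : (fun ω => (fun j : {j : Fin n // j ≠ i} => Z ω j.1)) = V at *
  have hVa : ∀ ω, (fun j : {j : Fin n // j ≠ i} => Z ω j.1) = V ω := fun ω => by rw [← hVdef]
  simp only [hVa] at hXhat ⊢
  obtain ⟨C₀, hC₀⟩ := hbdd₀
  obtain ⟨C₁, hC₁⟩ := hbdd₁
  obtain ⟨C₂, hC₂⟩ := hbdd₂
  have hL2 : MemLp (N i) 2 μ :=
    (memLp_two_iff_integrable_sq (hNmeas i).aestronglyMeasurable).2 (hN2int i)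
  have hN1 : Integrable (N i) μ := hL2.integrable (by norm_num)
  have hN3 : Integrable (fun ω => (N i ω) ^ 3) μ := by
    refine (hN3int i).mono' ((hNmeas i).pow_const 3).aestronglyMeasurable ?_
    exact Filter.Eventually.of_forall fun ω => by simp
  obtain ⟨i1, e1⟩ := condExp_mul_eq_zero_of_indep_aux μ V hVmeas (N i) (hNmeas i) hYV
    (fun t => t ^ 2 - σ ^ 2) (by fun_prop) ((hN2int i).sub (integrable_const _))
    (by rw [integral_sub (hN2int i) (integrable_const _), hvar i]; simp)
    (fun v => 1 - 4 * a₂ v * x i - 2 * a₁ v) (by fun_prop)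
    ⟨1 + 4 * C₂ * |x i| + 2 * C₁, fun v => by
      refine (abs_sub _ _).trans (add_le_add ((abs_sub _ _).trans (add_le_add (by simp) ?_)) ?_)
      · rw [abs_mul, abs_mul, abs_of_pos (by norm_num : (0:ℝ) < 4)]
        have := hC₂ v
        gcongr
      · rw [abs_mul, abs_of_pos (by norm_num : (0:ℝ) < 2)]
        have := hC₁ v
        gcongr⟩
  obtain ⟨i2, e2⟩ := condExp_mul_eq_zero_of_indep_aux μ V hVmeas (N i) (hNmeas i) hYV
    (fun t => t) (by fun_prop) hN1 (hmean i)
    (fun v => 2 * x i + (4 * σ ^ 2 - 2 * x i ^ 2) * a₂ v + (- 2 * x i) * a₁ v + (-2) * a₀ v)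
    (by fun_prop)
    ⟨|2 * x i| + |4 * σ ^ 2 - 2 * x i ^ 2| * C₂ + |- 2 * x i| * C₁ + |(-2 : ℝ)| * C₀, fun v => by
      have h0 := hC₀ v
      have h1 := hC₁ v
      have h2 := hC₂ v
      refine (abs_add_le _ _).trans (add_le_add ((abs_add_le _ _).trans
        (add_le_add ((abs_add_le _ _).trans (add_le_add le_rfl ?_)) ?_)) ?_)
      all_goals
        rw [abs_mul]
        gcongr⟩
  obtain ⟨i3, e3⟩ := condExp_mul_eq_zero_of_indep_aux μ V hVmeas (N i) (hNmeas i) hYV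
    (fun t => t ^ 3) (by fun_prop) hN3 (hthird i)
    (fun v => (-2) * a₂ v) (by fun_prop)
    ⟨|(-2 : ℝ)| * C₂, fun v => by
      have h2 := hC₂ v
      rw [abs_mul]
      gcongr⟩
  have key : (fun ω => (Z ω i - Xhat ω) ^ 2
        + σ ^ 2 * (2 * a₁ (V ω) + 4 * a₂ (V ω) * Z ω i - 1))
      = (fun ω => (x i - Xhat ω) ^ 2)
        + ((fun ω => (1 - 4 * a₂ (V ω) * x i - 2 * a₁ (V ω)) * ((N i ω) ^ 2 - σ ^ 2))
        + ((fun ω => (2 * x i + (4 * σ ^ 2 - 2 * x i ^ 2) * a₂ (V ω) + (- 2 * x i) * a₁ (V ω)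
            + (-2) * a₀ (V ω)) * N i ω)
        + (fun ω => ((-2) * a₂ (V ω)) * (N i ω) ^ 3))) := by
    funext ω
    simp only [Pi.add_apply, hXhat, hZ]
    ring
  rw [key]
  refine (condExp_add hint2 (i1.add (i2.add i3)) _).trans ?_
  filter_upwards [condExp_add i1 (i2.add i3) (MeasurableSpace.comap V inferInstance),
    condExp_add i2 i3 (MeasurableSpace.comap V inferInstance), e1, e2, e3] with ω q1 q2 r1 r2 r3
  simp only [Pi.add_apply] at q1 q2 ⊢
  rw [q1, q2, r1, r2, r3]
  simp
end
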